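/- For every real k with 0 ≤ k < 1, one has 1 − k/E(k) ≤ 2·(1 − k²)·K(k). -/

import Mathlib

open MeasureTheory

/-- Complete Legendre elliptic integral of the second kind. -/
noncomputable def ellE (k : ℝ) : ℝ :=
  ∫ t in (0:ℝ)..1, Real.sqrt ((1 - k^2 * t^2) / (1 - t^2))

/-- Complete Legendre elliptic integral of the first kind. -/
noncomputable def ellK (k : ℝ) : ℝ :=
  ∫ t in (0:ℝ)..1, 1 / Real.sqrt ((1 - t^2) * (1 - k^2 * t^2))

/-- The function `Ψ(k) = k / E(k)`. -/
noncomputable def PsiFn (k : ℝ) : ℝ := k / ellE k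

/-- `Φ`, the inverse on `[0,1]` of the strictly increasing bijection `Ψ`. -/
noncomputable def PhiFn (x : ℝ) : ℝ :=
  sSup {y : ℝ | y ∈ Set.Icc (0:ℝ) 1 ∧ PsiFn y ≤ x}

/-- The function `𝒥(x) = (π²/4) ∫_{Φ(2x/π)}^1 dt/(t E(t)²)`. -/
noncomputable def Jcal (x : ℝ) : ℝ :=
  (Real.pi^2 / 4) * ∫ t in PhiFn (2*x/Real.pi)..(1:ℝ), 1 / (t * (ellE t)^2)

/-- The function `𝒥_l(c) = (π/2) ∫_c^{πl/2} dτ/(Φ(2τ/(πl)) K(Φ(2τ/(πl))))`. -/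
noncomputable def Jl (l c : ℝ) : ℝ :=
  (Real.pi / 2) * ∫ τ in c..(Real.pi * l / 2),
    1 / (PhiFn (2*τ/(Real.pi*l)) * ellK (PhiFn (2*τ/(Real.pi*l))))

/-- The approximation `λ̃_n(c)`. -/
noncomputable def lambdaTilde (n : ℕ) (c : ℝ) : ℝ :=
  (1/2) * Real.exp (-(Real.pi^2 * ((n:ℝ) + 1/2) / 2) *
    ∫ t in PhiFn (2*c/(Real.pi*((n:ℝ)+1/2)))..(1:ℝ), 1 / (t * (ellE t)^2))

/-- The kernel `sin(c(x-y))/(π(x-y))`, with value `c/π` on the diagonal. -/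
noncomputable def sincKernel (c x y : ℝ) : ℝ :=
  if x = y then c / Real.pi else Real.sin (c*(x-y)) / (Real.pi * (x-y))

/-- The quadratic form `⟨Q_c f, f⟩` of the time-and-frequency limiting operator `Q_c`. -/
noncomputable def QForm (c : ℝ) (f : ℝ → ℝ) : ℝ :=
  ∫ x in Set.Ioo (-1:ℝ) 1, ∫ y in Set.Ioo (-1:ℝ) 1, sincKernel c x y * f y * f x

/-- The `(n+1)`-st eigenvalue `λ_n(c)` of `Q_c`, via the Courant–Fischer min-max principle. -/
noncomputable def lambda (n : ℕ) (c : ℝ) : ℝ :=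
  ⨆ V : {V : Submodule ℝ (Lp ℝ 2 (volume.restrict (Set.Ioo (-1:ℝ) 1))) //
          Module.finrank ℝ V = n + 1},
    ⨅ f : {f : Lp ℝ 2 (volume.restrict (Set.Ioo (-1:ℝ) 1)) // f ∈ V.1 ∧ f ≠ 0},
      QForm c (f.1 : ℝ → ℝ) / ‖f.1‖^2

lemma intervalIntegrable_ellK_integrand {k : ℝ} (hk : 0 ≤ k) (hk1 : k < 1) :
    IntervalIntegrable (fun t : ℝ => 1 / Real.sqrt ((1 - t^2) * (1 - k^2 * t^2)))
      volume 0 1 := by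
  have h0 : IntervalIntegrable (fun t : ℝ => (1 - t) ^ (-(1/2) : ℝ)) volume 0 1 := by
    have h := (intervalIntegral.intervalIntegrable_rpow' (a := 0) (b := 1)
      (r := (-(1/2) : ℝ)) (by norm_num)).comp_sub_left 1
    simpa using h.symm
  refine (h0.mul_const (1 / Real.sqrt (1 - k^2))).mono_fun' ?_ ?_
  · exact (by fun_prop : Measurable _).aestronglyMeasurable
  · refine ae_restrict_of_forall_mem measurableSet_uIoc fun t ht => ?_
    rw [Set.uIoc_of_le zero_le_one] at ht
    obtain ⟨ht0, ht1⟩ := ht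
    have hk2 : 0 < 1 - k^2 := by nlinarith
    beta_reduce
    rw [Real.norm_of_nonneg (by positivity)]
    rcases ht1.eq_or_lt with rfl | ht1
    · simp
    have h1t : 0 < 1 - t := by linarith
    rw [Real.rpow_neg h1t.le, ← Real.sqrt_eq_rpow, ← one_div, one_div_mul_one_div,
      ← Real.sqrt_mul h1t.le]
    refine one_div_le_one_div_of_le (Real.sqrt_pos.2 (by positivity)) (Real.sqrt_le_sqrt ?_)
    apply mul_le_mul <;> nlinarith [mul_nonneg (sq_nonneg k) (by nlinarith : 0 ≤ 1 - t^2)]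

lemma ellE_integrand_le {k t : ℝ} (hk : 0 ≤ k) (hk1 : k < 1) (ht0 : 0 ≤ t) (ht1 : t ≤ 1) :
    Real.sqrt ((1 - k^2 * t^2) / (1 - t^2)) ≤
      (1 - k^2) * (1 / Real.sqrt ((1 - t^2) * (1 - k^2 * t^2))) + k^2 := by
  rcases ht1.eq_or_lt with rfl | ht1
  · simp [sq_nonneg]
  have ha : 0 < 1 - t^2 := by nlinarith
  have hab : 1 - t^2 ≤ 1 - k^2 * t^2 := by
    nlinarith [mul_nonneg (sq_nonneg t) (by nlinarith : 0 ≤ 1 - k^2)]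
  have hb : 0 < 1 - k^2 * t^2 := ha.trans_le hab
  have hs : 0 < Real.sqrt ((1 - t^2) * (1 - k^2 * t^2)) := Real.sqrt_pos.2 (by positivity)
  have hle : 1 - t^2 ≤ Real.sqrt ((1 - t^2) * (1 - k^2 * t^2)) :=
    Real.le_sqrt_of_sq_le (by nlinarith)
  have heq : Real.sqrt ((1 - k^2 * t^2) / (1 - t^2)) =
      (1 - k^2 * t^2) / Real.sqrt ((1 - t^2) * (1 - k^2 * t^2)) := by
    rw [eq_div_iff hs.ne', ← Real.sqrt_mul (by positivity),
      show (1 - k^2 * t^2) / (1 - t^2) * ((1 - t^2) * (1 - k^2 * t^2)) = (1 - k^2 * t^2)^2 by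
        field_simp, Real.sqrt_sq hb.le]
  rw [heq, div_le_iff₀ hs, add_mul, mul_assoc, one_div_mul_cancel hs.ne']
  nlinarith [mul_le_mul_of_nonneg_left hle (sq_nonneg k)]

lemma intervalIntegrable_ellE_integrand {k : ℝ} (hk : 0 ≤ k) (hk1 : k < 1) :
    IntervalIntegrable (fun t : ℝ => Real.sqrt ((1 - k^2 * t^2) / (1 - t^2))) volume 0 1 := by
  refine (((intervalIntegrable_ellK_integrand hk hk1).const_mul (1 - k^2)).add
    (intervalIntegrable_const (c := k^2))).mono_fun' ?_ ?_
  · exact (by fun_prop : Measurable _).aestronglyMeasurable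
  · refine ae_restrict_of_forall_mem measurableSet_uIoc fun t ht => ?_
    rw [Set.uIoc_of_le zero_le_one] at ht
    beta_reduce
    rw [Real.norm_of_nonneg (Real.sqrt_nonneg _)]
    exact ellE_integrand_le hk hk1 ht.1.le ht.2

lemma ellE_le {k : ℝ} (hk : 0 ≤ k) (hk1 : k < 1) :
    ellE k ≤ (1 - k^2) * ellK k + k^2 := by
  have hK := (intervalIntegrable_ellK_integrand hk hk1).const_mul (1 - k^2)
  have h := intervalIntegral.integral_mono_on zero_le_one
    (intervalIntegrable_ellE_integrand hk hk1)
    (hK.add (intervalIntegrable_const (c := k^2)))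
    fun t ht => ellE_integrand_le hk hk1 ht.1 ht.2
  rw [intervalIntegral.integral_add hK intervalIntegrable_const,
    intervalIntegral.integral_const_mul] at h
  simpa [ellE, ellK] using h

lemma one_le_ellE {k : ℝ} (hk : 0 ≤ k) (hk1 : k < 1) : 1 ≤ ellE k := by
  have h := intervalIntegral.integral_mono_on_of_le_Ioo zero_le_one
    (intervalIntegrable_const (c := (1 : ℝ)))
    (intervalIntegrable_ellE_integrand hk hk1) fun t ht => by
      have ha : 0 < 1 - t^2 := by nlinarith [ht.1, ht.2]
      rw [Real.one_le_sqrt, one_le_div ha]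
      nlinarith [mul_nonneg (sq_nonneg t) (by nlinarith : 0 ≤ 1 - k^2)]
  simpa [ellE] using h

lemma ellK_nonneg (k : ℝ) : 0 ≤ ellK k :=
  intervalIntegral.integral_nonneg zero_le_one fun _ _ => by positivity

theorem stmt18 (k : ℝ) (hk : 0 ≤ k) (hk1 : k < 1) :
    1 - k / ellE k ≤ 2 * (1 - k^2) * ellK k := by
  have hE := one_le_ellE hk hk1
  have hEpos : 0 < ellE k := by linarith
  have hP : 0 ≤ (1 - k^2) * ellK k := mul_nonneg (by nlinarith) (ellK_nonneg k)
  rw [one_sub_div hEpos.ne', div_le_iff₀ hEpos]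
  nlinarith [ellE_le hk hk1, mul_le_mul_of_nonneg_left hE hP, mul_nonneg hk (sub_nonneg.2 hk1.le)]
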